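/- Every TAP instance in which every school's preference order is the restriction of a common master list of the applicants (TAP-AM) admits exactly one stable matching. -/

import Mathlib

structure TAP (A : Type*) (S : Type*) (P : Type*) where
  ptype : A → Finset P
  prefA : A → List S
  cap : S → P → ℕ
  prefS : S → List A

namespace TAP

variable {A S P : Type*} [DecidableEq A] [DecidableEq S] [DecidableEq P] (J : TAP A S P)

def WellFormed : Prop :=
  (∀ a, (J.ptype a).card = 2) ∧ (∀ a, (J.prefA a).Nodup) ∧
  (∀ s, (J.prefS s).Nodup) ∧ (∀ a s, a ∈ J.prefS s ↔ s ∈ J.prefA a)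

def IsAssignment (M : Finset (A × S)) : Prop :=
  (∀ x ∈ M, x.2 ∈ J.prefA x.1) ∧
  ∀ a s s', (a, s) ∈ M → (a, s') ∈ M → s = s'

def Mp (M : Finset (A × S)) (s : S) (p : P) : Finset A :=
  (M.filter (fun x => x.2 = s ∧ p ∈ J.ptype x.1)).image Prod.fst

def Mpr (M : Finset (A × S)) (s : S) (p r : P) : Finset A :=
  (M.filter (fun x => x.2 = s ∧ J.ptype x.1 = {p, r})).image Prod.fst

def IsMatching (M : Finset (A × S)) : Prop :=
  J.IsAssignment M ∧ ∀ s p, (J.Mp M s p).card ≤ J.cap s p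

def Undersub (M : Finset (A × S)) (s : S) (p : P) : Prop :=
  (J.Mp M s p).card < J.cap s p

def PrefersA (a : A) (s s' : S) : Prop :=
  s ∈ J.prefA a ∧ s' ∈ J.prefA a ∧ (J.prefA a).idxOf s < (J.prefA a).idxOf s'

def PrefersS (s : S) (a a' : A) : Prop :=
  a ∈ J.prefS s ∧ a' ∈ J.prefS s ∧ (J.prefS s).idxOf a < (J.prefS s).idxOf a'

def Unassigned (M : Finset (A × S)) (a : A) : Prop := ∀ s, (a, s) ∉ M

def Blocks (M : Finset (A × S)) (a : A) (s : S) : Prop :=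
  s ∈ J.prefA a ∧
  (Unassigned M a ∨ ∃ s', (a, s') ∈ M ∧ J.PrefersA a s s') ∧
  ∃ p₁ p₂, p₁ ≠ p₂ ∧ J.ptype a = {p₁, p₂} ∧
    ((J.Undersub M s p₁ ∧ J.Undersub M s p₂) ∨
     (J.Undersub M s p₁ ∧ ∃ b ∈ J.Mp M s p₂, J.PrefersS s a b) ∨
     (J.Undersub M s p₂ ∧ ∃ b ∈ J.Mp M s p₁, J.PrefersS s a b) ∨
     (∃ b ∈ J.Mpr M s p₁ p₂, J.PrefersS s a b) ∨
     (∃ b₁ ∈ J.Mp M s p₁, ∃ b₂ ∈ J.Mp M s p₂, b₁ ≠ b₂ ∧ J.PrefersS s a b₁ ∧ J.PrefersS s a b₂))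

def Stable (M : Finset (A × S)) : Prop :=
  J.IsMatching M ∧ ∀ a s, ¬ J.Blocks M a s

end TAP

theorem List.idxOf_filter_lt_idxOf_filter_iff {α : Type*} [DecidableEq α] (q : α → Bool)
    (l : List α) {a b : α} (ha : q a = true) (hb : q b = true) :
    (l.filter q).idxOf a < (l.filter q).idxOf b ↔ l.idxOf a < l.idxOf b := by
  induction l with
  | nil => simp
  | cons x l ih => grind

namespace TAP

section Greedy

variable {A S P : Type*} [DecidableEq A] [DecidableEq S] [DecidableEq P] (J : TAP A S P)
  (r : A → ℕ)

/-- School `s` still has room for `a` once the applicants ranked before `a` are placed by `M`. -/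
def Available (M : Finset (A × S)) (a : A) (s : S) : Prop :=
  s ∈ J.prefA a ∧
    ∀ p ∈ J.ptype a, (J.Mp (M.filter (fun x => r x.1 < r a)) s p).card < J.cap s p

/-- School `s` is the favourite school of `a` among those available to `a`. -/
def IsBest (M : Finset (A × S)) (a : A) (s : S) : Prop :=
  J.Available r M a s ∧
    ∀ s', J.Available r M a s' → (J.prefA a).idxOf s ≤ (J.prefA a).idxOf s'

/-- `M` is an outcome of the serial dictatorship in the order of the rank `r`. -/
def Greedy (M : Finset (A × S)) : Prop := ∀ a s, (a, s) ∈ M ↔ J.IsBest r M a s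

variable {J r}

theorem mem_Mp {M : Finset (A × S)} {s : S} {p : P} {a : A} :
    a ∈ J.Mp M s p ↔ (a, s) ∈ M ∧ p ∈ J.ptype a := by
  simp only [Mp, Finset.mem_image, Finset.mem_filter, Prod.exists]
  grind

theorem mem_Mpr {M : Finset (A × S)} {s : S} {p q : P} {a : A} :
    a ∈ J.Mpr M s p q ↔ (a, s) ∈ M ∧ J.ptype a = {p, q} := by
  simp only [Mpr, Finset.mem_image, Finset.mem_filter, Prod.exists]
  grind

theorem mem_Mp_filter {M : Finset (A × S)} {s : S} {p : P} {a b : A} :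
    b ∈ J.Mp (M.filter (fun x => r x.1 < r a)) s p ↔
      ((b, s) ∈ M ∧ r b < r a) ∧ p ∈ J.ptype b := by
  simp [mem_Mp]

theorem isBest_congr {M M' : Finset (A × S)} {a : A}
    (h : ∀ x : A × S, r x.1 < r a → (x ∈ M ↔ x ∈ M')) (s : S) :
    J.IsBest r M a s ↔ J.IsBest r M' a s := by
  have : M.filter (fun x => r x.1 < r a) = M'.filter (fun x => r x.1 < r a) := by
    ext x
    simp only [Finset.mem_filter]
    grind
  simp only [IsBest, Available, this]

theorem IsBest.eq {M : Finset (A × S)} {a : A} {s s' : S} (h : J.IsBest r M a s)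
    (h' : J.IsBest r M a s') : s = s' :=
  (List.idxOf_inj h.1.1).1 (le_antisymm (h.2 _ h'.1) (h'.2 _ h.1))

theorem exists_isBest {M : Finset (A × S)} {a : A} {s : S} (h : J.Available r M a s) :
    ∃ t, J.IsBest r M a t := by
  obtain ⟨t, ht, hmin⟩ := (measure fun s => (J.prefA a).idxOf s).wf.has_min
    {s | J.Available r M a s} ⟨s, h⟩
  exact ⟨t, ht, fun s' hs' => not_lt.1 (hmin s' hs')⟩

theorem Greedy.eq {M M' : Finset (A × S)} (h : J.Greedy r M) (h' : J.Greedy r M') : M = M' := by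
  have key : ∀ n a, r a = n → ∀ s, (a, s) ∈ M ↔ (a, s) ∈ M' := by
    intro n
    induction n using Nat.strong_induction_on with
    | _ n ih =>
      intro a ha s
      rw [h, h']
      exact isBest_congr (fun x hx => ih _ (ha ▸ hx) x.1 rfl x.2) s
  ext ⟨a, s⟩
  exact key _ a rfl s

theorem exists_greedy_below (hr : Function.Injective r) (n : ℕ) :
    ∃ M : Finset (A × S), (∀ x ∈ M, r x.1 < n) ∧
      ∀ a, r a < n → ∀ s, (a, s) ∈ M ↔ J.IsBest r M a s := by
  induction n with
  | zero => exact ⟨∅, by simp, by simp⟩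
  | succ n ih =>
    obtain ⟨M, hM, hbest⟩ := ih
    by_cases hex : ∃ a s, r a = n ∧ J.IsBest r M a s
    · obtain ⟨a, s, ha, hs⟩ := hex
      have hcongr : ∀ b, r b < n + 1 → ∀ t,
          J.IsBest r (insert (a, s) M) b t ↔ J.IsBest r M b t := by
        intro b hb t
        refine isBest_congr (fun x hx => ?_) t
        grind
      refine ⟨insert (a, s) M, by grind, fun b hb t => ?_⟩
      rw [hcongr b hb t]
      rcases Nat.lt_succ_iff_lt_or_eq.1 hb with hlt | heq
      · rw [← hbest b hlt]
        grind
      · obtain rfl : b = a := hr (heq.trans ha.symm)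
        have : (b, t) ∉ M := fun hmem => absurd (hM _ hmem) (by simp [heq])
        constructor
        · grind
        · intro ht
          simp [ht.eq hs]
    · refine ⟨M, fun x hx => (hM x hx).trans n.lt_succ_self, fun b hb t => ?_⟩
      rcases Nat.lt_succ_iff_lt_or_eq.1 hb with hlt | heq
      · exact hbest b hlt t
      · exact ⟨fun hmem => absurd (hM _ hmem) (by simp [heq]), fun h => (hex ⟨b, t, heq, h⟩).elim⟩

theorem exists_greedy (hr : Function.Injective r) {n : ℕ} (hn : ∀ a, r a < n) :
    ∃ M : Finset (A × S), J.Greedy r M :=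
  let ⟨M, _, h⟩ := exists_greedy_below (J := J) hr n
  ⟨M, fun a => h a (hn a)⟩

theorem Greedy.isMatching (hr : Function.Injective r) {M : Finset (A × S)} (h : J.Greedy r M) :
    J.IsMatching M := by
  refine ⟨⟨fun x hx => ((h x.1 x.2).1 hx).1.1,
    fun a s s' hs hs' => ((h a s).1 hs).eq ((h a s').1 hs')⟩, fun s p => ?_⟩
  rcases (J.Mp M s p).eq_empty_or_nonempty with he | hne
  · simp [he]
  · obtain ⟨a, ha, hmax⟩ := Finset.exists_max_image _ r hne
    have ha' := mem_Mp.1 ha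
    have hlt := ((h a s).1 ha'.1).1.2 p ha'.2
    have hsub : J.Mp M s p ⊆ insert a (J.Mp (M.filter (fun x => r x.1 < r a)) s p) := by
      intro b hb
      rw [Finset.mem_insert, mem_Mp_filter]
      by_cases hba : b = a
      · exact Or.inl hba
      · exact Or.inr ⟨⟨(mem_Mp.1 hb).1, lt_of_le_of_ne (hmax b hb) (hr.ne hba)⟩, (mem_Mp.1 hb).2⟩
    have := (Finset.card_le_card hsub).trans (Finset.card_insert_le _ _)
    omega

theorem Mp_filter_subset (M : Finset (A × S)) (a : A) (s : S) (p : P) :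
    J.Mp (M.filter (fun x => r x.1 < r a)) s p ⊆ J.Mp M s p :=
  fun _ hb => mem_Mp.2 ⟨(mem_Mp_filter.1 hb).1.1, (mem_Mp_filter.1 hb).2⟩

theorem available_of_mem {M : Finset (A × S)} (h : J.IsMatching M) {a : A} {s : S}
    (hmem : (a, s) ∈ M) : J.Available r M a s := by
  refine ⟨h.1.1 _ hmem, fun p hp => lt_of_lt_of_le (Finset.card_lt_card ?_) (h.2 s p)⟩
  refine (Finset.ssubset_iff_of_subset (Mp_filter_subset M a s p)).2 ⟨a, mem_Mp.2 ⟨hmem, hp⟩, ?_⟩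
  simp [mem_Mp_filter]

theorem undersub_or_exists_of_available (hr : Function.Injective r) {M : Finset (A × S)} {a : A}
    {s : S} (hav : J.Available r M a s) (hnot : (a, s) ∉ M) {p : P} (hp : p ∈ J.ptype a) :
    J.Undersub M s p ∨ ∃ b ∈ J.Mp M s p, r a < r b := by
  by_contra! hcon
  refine hcon.1 ((Finset.card_le_card fun b hb => ?_).trans_lt (hav.2 p hp))
  have hb' := mem_Mp.1 hb
  refine mem_Mp_filter.2 ⟨⟨hb'.1, lt_of_le_of_ne (hcon.2 b hb) (hr.ne ?_)⟩, hb'.2⟩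
  rintro rfl
  exact hnot hb'.1

theorem blocks_of_available (hr : Function.Injective r) (hcard : ∀ a, (J.ptype a).card = 2)
    (hpref : ∀ s a b, J.PrefersS s a b ↔ s ∈ J.prefA a ∧ s ∈ J.prefA b ∧ r a < r b)
    {M : Finset (A × S)} (hM : J.IsMatching M) {a : A} {s : S} (hav : J.Available r M a s)
    (hnot : (a, s) ∉ M)
    (h : Unassigned M a ∨ ∃ s', (a, s') ∈ M ∧ J.PrefersA a s s') : J.Blocks M a s := by
  obtain ⟨p, q, hpq, htype⟩ := Finset.card_eq_two.1 (hcard a)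
  have hpre : ∀ u b, b ∈ J.Mp M s u → r a < r b → J.PrefersS s a b := fun u b hb hlt =>
    (hpref s a b).2 ⟨hav.1, hM.1.1 _ (mem_Mp.1 hb).1, hlt⟩
  refine ⟨hav.1, h, p, q, hpq, htype, ?_⟩
  rcases undersub_or_exists_of_available hr hav hnot (p := p) (by simp [htype]) with
    hp | ⟨b, hb, hab⟩ <;>
  rcases undersub_or_exists_of_available hr hav hnot (p := q) (by simp [htype]) with
    hq | ⟨c, hc, hac⟩
  · exact Or.inl ⟨hp, hq⟩
  · exact Or.inr (Or.inl ⟨hp, c, hc, hpre _ c hc hac⟩)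
  · exact Or.inr (Or.inr (Or.inl ⟨hq, b, hb, hpre _ b hb hab⟩))
  · by_cases hbc : b = c
    · subst hbc
      refine Or.inr (Or.inr (Or.inr (Or.inl ⟨b, mem_Mpr.2 ⟨(mem_Mp.1 hb).1, ?_⟩,
        hpre _ b hb hab⟩)))
      refine (Finset.eq_of_subset_of_card_le ?_ ?_).symm
      · intro u hu
        rcases Finset.mem_insert.1 hu with rfl | hu
        · exact (mem_Mp.1 hb).2
        · rw [Finset.mem_singleton.1 hu]
          exact (mem_Mp.1 hc).2
      · rw [hcard b, Finset.card_pair hpq]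
    · exact Or.inr (Or.inr (Or.inr (Or.inr
        ⟨b, hb, c, hc, hbc, hpre _ b hb hab, hpre _ c hc hac⟩)))

theorem Greedy.stable (hr : Function.Injective r)
    (hpref : ∀ s a b, J.PrefersS s a b ↔ s ∈ J.prefA a ∧ s ∈ J.prefA b ∧ r a < r b)
    {M : Finset (A × S)} (h : J.Greedy r M) : J.Stable M := by
  have hM := h.isMatching hr
  refine ⟨hM, fun a s ⟨hs, hwant, p, q, hpq, htype, hroom⟩ => ?_⟩
  have hnav : ¬ J.Available r M a s := by
    intro hav
    rcases hwant with hun | ⟨s', hs', hlt⟩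
    · obtain ⟨t, ht⟩ := exists_isBest hav
      exact hun t ((h a t).2 ht)
    · exact absurd (((h a s').1 hs').2 s hav) (not_le.2 hlt.2.2)
  have hfull : ∃ u ∈ J.ptype a, ¬ J.Undersub M s u ∧ ∀ b ∈ J.Mp M s u, r b < r a := by
    by_contra! hcon
    refine hnav ⟨hs, fun u hu => ?_⟩
    by_cases hun : J.Undersub M s u
    · exact (Finset.card_le_card (Mp_filter_subset M a s u)).trans_lt hun
    · obtain ⟨b, hb, hab⟩ := hcon u hu hun
      refine lt_of_lt_of_le (Finset.card_lt_card ?_) (hM.2 s u)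
      refine (Finset.ssubset_iff_of_subset (Mp_filter_subset M a s u)).2 ⟨b, hb, fun hb' => ?_⟩
      exact absurd (mem_Mp_filter.1 hb').1.2 (not_lt.2 hab)
  obtain ⟨u, hu, hun, hbefore⟩ := hfull
  have hno : ∀ b ∈ J.Mp M s u, ¬ J.PrefersS s a b := fun b hb hab =>
    lt_asymm (hbefore b hb) ((hpref s a b).1 hab).2.2
  have hMpr : ∀ b ∈ J.Mpr M s p q, b ∈ J.Mp M s u := fun b hb =>
    mem_Mp.2 ⟨(mem_Mpr.1 hb).1, by rw [(mem_Mpr.1 hb).2, ← htype]; exact hu⟩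
  rw [htype, Finset.mem_insert, Finset.mem_singleton] at hu
  rcases hu with rfl | rfl <;> grind

theorem Stable.greedy (hr : Function.Injective r) (hcard : ∀ a, (J.ptype a).card = 2)
    (hpref : ∀ s a b, J.PrefersS s a b ↔ s ∈ J.prefA a ∧ s ∈ J.prefA b ∧ r a < r b)
    {M : Finset (A × S)} (h : J.Stable M) : J.Greedy r M := by
  intro a s
  constructor
  · intro hs
    have hav : J.Available r M a s := available_of_mem h.1 hs
    refine ⟨hav, fun s' hav' => ?_⟩
    by_contra! hlt
    refine h.2 a s' (blocks_of_available hr hcard hpref h.1 hav' (fun hs' => ?_)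
      (Or.inr ⟨s, hs, hav'.1, hav.1, hlt⟩))
    exact absurd hlt (by rw [h.1.1.2 a s s' hs hs']; exact lt_irrefl _)
  · intro hbest
    by_contra hnot
    refine h.2 a s (blocks_of_available hr hcard hpref h.1 hbest.1 hnot ?_)
    by_cases hun : Unassigned M a
    · exact Or.inl hun
    · obtain ⟨s', hs'⟩ : ∃ s', (a, s') ∈ M := by simpa [Unassigned] using hun
      have hav' : J.Available r M a s' := available_of_mem h.1 hs'
      refine Or.inr ⟨s', hs', hbest.1.1, hav'.1, lt_of_le_of_ne (hbest.2 s' hav') fun heq => ?_⟩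
      exact hnot ((List.idxOf_inj hbest.1.1).1 heq ▸ hs')

end Greedy

end TAP

theorem stmt3 {A S P : Type*} [DecidableEq A] [DecidableEq S] [DecidableEq P]
    (J : TAP A S P) (hwf : J.WellFormed) (ml : List A) (hnd : ml.Nodup)
    (hall : ∀ a : A, a ∈ ml)
    (hmaster : ∀ s : S, J.prefS s = ml.filter (fun a => decide (s ∈ J.prefA a))) :
    ∃! M : Finset (A × S), J.Stable M := by
  have hr : Function.Injective (fun a => ml.idxOf a) := fun a b hab =>
    (List.idxOf_inj (hall a)).1 hab
  have hpref : ∀ s a b, J.PrefersS s a b ↔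
      s ∈ J.prefA a ∧ s ∈ J.prefA b ∧ ml.idxOf a < ml.idxOf b := by
    intro s a b
    simp only [TAP.PrefersS, hwf.2.2.2]
    refine and_congr_right fun ha => and_congr_right fun hb => ?_
    rw [hmaster s]
    exact List.idxOf_filter_lt_idxOf_filter_iff _ ml (by simpa using ha) (by simpa using hb)
  obtain ⟨M, hM⟩ := TAP.exists_greedy (J := J) hr fun a => List.idxOf_lt_length_iff.2 (hall a)
  exact ⟨M, hM.stable hr hpref, fun M' hM' => (hM'.greedy hr hwf.1 hpref).eq hM⟩
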